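/- arXiv:1611.05796 — 2 statements merged into one kernel-verified Lean document; each statement's English description precedes it below -/
import Mathlib

section
/- For any two rate matrices Q₁, Q₂ indexed by a nonempty finite set 𝒳 and any real Δ ≥ 0, one has ‖e^{Q₁Δ} − e^{Q₂Δ}‖ ≤ Δ‖Q₁ − Q₂‖. -/
open scoped BigOperators

/-- The operator norm of a matrix induced by the supremum norm on `X → ℝ`:
`‖A‖ = max_{x} Σ_{y} |A x y|`. -/
noncomputable def matNorm {X : Type*} [Fintype X] (A : Matrix X X ℝ) : ℝ :=
  ⨆ x, ∑ y, |A x y|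

/-- A (transition) rate matrix: nonnegative off-diagonal entries, rows summing to zero. -/
def IsRateMatrix {X : Type*} [Fintype X] (Q : Matrix X X ℝ) : Prop :=
  (∀ x y, x ≠ y → 0 ≤ Q x y) ∧ ∀ x, ∑ y, Q x y = 0

/-- The matrix exponential `e^A = Σ_{k≥0} A^k / k!`. -/
noncomputable def mexp {X : Type*} [Fintype X] [DecidableEq X] (A : Matrix X X ℝ) :
    Matrix X X ℝ :=
  ∑' k : ℕ, ((k.factorial : ℝ)⁻¹) • A ^ k

section helpers
attribute [local instance] Matrix.linftyOpNormedRing Matrix.linftyOpNormedAlgebra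

theorem matNorm_eq_norm {X : Type*} [Fintype X] [Nonempty X] [DecidableEq X]
    (A : Matrix X X ℝ) : matNorm A = ‖A‖ := by
  rw [matNorm, Matrix.linfty_opNorm_def]
  apply le_antisymm
  · apply ciSup_le
    intro x
    have h := Finset.le_sup (f := fun i => ∑ j, ‖A i j‖₊) (Finset.mem_univ x)
    have h' := NNReal.coe_le_coe.2 h
    simpa using h'
  · obtain ⟨x, -, hx⟩ := Finset.exists_mem_eq_sup Finset.univ Finset.univ_nonempty
      (fun i => ∑ j, ‖A i j‖₊)
    rw [hx]
    have := le_ciSup (f := fun x => ∑ y, |A x y|) (Set.finite_range _).bddAbove x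
    simpa using this

theorem mexp_eq_exp {X : Type*} [Fintype X] [DecidableEq X]
    (A : Matrix X X ℝ) : mexp A = NormedSpace.exp A := by
  rw [mexp, NormedSpace.exp_eq_tsum ℝ]

theorem norm_exp_le_exp {X : Type*} [Fintype X] [Nonempty X] [DecidableEq X]
    (A : Matrix X X ℝ) : ‖NormedSpace.exp A‖ ≤ Real.exp ‖A‖ := by
  rw [NormedSpace.exp_eq_tsum ℝ, Real.exp_eq_exp_ℝ, NormedSpace.exp_eq_tsum ℝ]
  refine tsum_of_norm_bounded (NormedSpace.expSeries_summable' (𝕂 := ℝ) ‖A‖).hasSum ?_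
  intro n
  rw [norm_smul, smul_eq_mul]
  have : ‖((n.factorial : ℝ)⁻¹)‖ = (n.factorial : ℝ)⁻¹ := by
    rw [Real.norm_of_nonneg (by positivity)]
  rw [this]
  gcongr
  exact norm_pow_le A n

theorem norm_exp_rate {X : Type*} [Fintype X] [Nonempty X] [DecidableEq X]
    (Q : Matrix X X ℝ) (hQ : IsRateMatrix Q) (t : ℝ) (ht : 0 ≤ t) :
    ‖NormedSpace.exp (t • Q)‖ ≤ 1 := by
  obtain ⟨c, hc⟩ : ∃ c : ℝ, ∀ x, -Q x x ≤ c := by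
    obtain ⟨c, hc⟩ := (Set.finite_range (fun x => -Q x x)).bddAbove
    exact ⟨c, fun x => hc ⟨x, rfl⟩⟩
  have hB : ‖Q + c • (1 : Matrix X X ℝ)‖ ≤ c := by
    rw [← matNorm_eq_norm, matNorm]
    apply ciSup_le
    intro x
    have h1 : ∀ y, |(Q + c • (1 : Matrix X X ℝ)) x y| = Q x y + c * (1 : Matrix X X ℝ) x y := by
      intro y
      rw [Matrix.add_apply, Matrix.smul_apply, smul_eq_mul]
      apply abs_of_nonneg
      by_cases h : x = y
      · subst h
        simp only [Matrix.one_apply_eq]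
        linarith [hc x]
      · simpa [Matrix.one_apply_ne h] using hQ.1 x y h
    simp only [h1, Finset.sum_add_distrib, hQ.2, Matrix.one_apply]
    simp
  have e : t • Q = t • (Q + c • (1 : Matrix X X ℝ)) + algebraMap ℝ (Matrix X X ℝ) (-(t * c)) := by
    rw [Algebra.algebraMap_eq_smul_one, smul_add, smul_smul, neg_smul]
    abel
  have he : algebraMap ℝ (Matrix X X ℝ) (NormedSpace.exp (-(t * c))) =
      NormedSpace.exp (algebraMap ℝ (Matrix X X ℝ) (-(t * c))) :=
    NormedSpace.algebraMap_exp_comm (𝕂 := ℝ) (𝔸 := Matrix X X ℝ) (-(t * c))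
  rw [e, Matrix.exp_add_of_commute _ _ (Algebra.commute_algebraMap_right _ _),
    ← he, ← Real.exp_eq_exp_ℝ]
  refine (norm_mul_le _ _).trans ?_
  rw [norm_algebraMap', Real.norm_of_nonneg (Real.exp_pos _).le]
  calc _ ≤ Real.exp (t * c) * Real.exp (-(t * c)) := by
        gcongr
        refine (norm_exp_le_exp _).trans (Real.exp_le_exp.2 ?_)
        rw [norm_smul, Real.norm_of_nonneg ht]
        gcongr
    _ = 1 := by rw [← Real.exp_add]; simp

theorem norm_exp_sub_rate {X : Type*} [Fintype X] [Nonempty X] [DecidableEq X]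
    (Q₁ Q₂ : Matrix X X ℝ) (hQ₁ : IsRateMatrix Q₁) (hQ₂ : IsRateMatrix Q₂)
    (Δ : ℝ) (hΔ : 0 ≤ Δ) :
    ‖NormedSpace.exp (Δ • Q₁) - NormedSpace.exp (Δ • Q₂)‖ ≤ Δ * ‖Q₁ - Q₂‖ := by
  have hd : ∀ s : ℝ, HasDerivAt
      (fun s : ℝ => NormedSpace.exp (s • Q₁) * NormedSpace.exp ((Δ - s) • Q₂))
      (NormedSpace.exp (s • Q₁) * (Q₁ - Q₂) * NormedSpace.exp ((Δ - s) • Q₂)) s := by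
    intro s
    have h1 := hasDerivAt_exp_smul_const (𝕂 := ℝ) Q₁ s
    have h2 := (hasDerivAt_exp_smul_const' (𝕂 := ℝ) Q₂ (Δ - s)).scomp s
      ((hasDerivAt_id s).const_sub Δ)
    refine (h1.mul h2).congr_deriv ?_
    simp only [Function.comp, neg_smul, one_smul]
    noncomm_ring
  have := norm_image_sub_le_of_norm_deriv_le_segment' (a := 0) (b := Δ) (C := ‖Q₁ - Q₂‖)
    (fun s _ => (hd s).hasDerivWithinAt) (fun s hs => by
      have a1 := norm_exp_rate Q₁ hQ₁ s hs.1
      have a2 := norm_exp_rate Q₂ hQ₂ (Δ - s) (by linarith [hs.2])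
      calc _ ≤ ‖NormedSpace.exp (s • Q₁)‖ * ‖Q₁ - Q₂‖ * ‖NormedSpace.exp ((Δ - s) • Q₂)‖ :=
            (norm_mul_le _ _).trans (by gcongr; exact norm_mul_le _ _)
        _ ≤ 1 * ‖Q₁ - Q₂‖ * 1 := by gcongr
        _ = _ := by ring) Δ ⟨hΔ, le_rfl⟩
  simpa [mul_comm] using this

end helpers

theorem stmt6 {X : Type*} [Fintype X] [Nonempty X] [DecidableEq X]
    (Q₁ Q₂ : Matrix X X ℝ) (hQ₁ : IsRateMatrix Q₁) (hQ₂ : IsRateMatrix Q₂)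
    (Δ : ℝ) (hΔ : 0 ≤ Δ) :
    matNorm (mexp (Δ • Q₁) - mexp (Δ • Q₂)) ≤ Δ * matNorm (Q₁ - Q₂) := by
  rw [matNorm_eq_norm, matNorm_eq_norm, mexp_eq_exp, mexp_eq_exp]
  exact norm_exp_sub_rate Q₁ Q₂ hQ₁ hQ₂ Δ hΔ
end

section
/- Let Q̲ be a lower transition rate operator on ℝ^𝒳, and let 𝒬_Q̲ := {Q : Q is a rate matrix and Qf ≥ Q̲f pointwise for all f ∈ ℝ^𝒳} be its set of dominating rate matrices. Then 𝒬_Q̲ is closed (as a subset of the space of real matrices indexed by 𝒳), convex, and has separately specified rows: every rate matrix Q such that, for each x ∈ 𝒳, the row Q(x,·) equals Q'(x,·) for some Q' ∈ 𝒬_Q̲, itself belongs to 𝒬_Q̲. -/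
open scoped BigOperators

/-- A lower transition rate operator on `ℝ^𝒳`: maps constants to zero (LR1), is
nonnegative on off-diagonal indicators (LR2), super-additive (LR3), and
non-negatively homogeneous (LR4). -/
def IsLowerTransitionRateOperator {X : Type*} [Fintype X] [DecidableEq X]
    (Q : (X → ℝ) → (X → ℝ)) : Prop :=
  (∀ c : ℝ, Q (fun _ => c) = 0) ∧
  (∀ x y : X, y ≠ x → 0 ≤ Q (Pi.single y 1) x) ∧
  (∀ f g : X → ℝ, ∀ x : X, Q f x + Q g x ≤ Q (f + g) x) ∧
  (∀ c : ℝ, 0 ≤ c → ∀ f : X → ℝ, Q (c • f) = c • Q f)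

/-- The set of rate matrices dominating a given operator `Q̲`:
`𝒬_Q̲ = {Q rate matrix : Qf ≥ Q̲f for all f}`, where a matrix acts on `f ∈ ℝ^𝒳`
by `[Qf](x) = Σ_y Q(x,y) f(y)`. -/
def dominatingSet {X : Type*} [Fintype X] (Ql : (X → ℝ) → (X → ℝ)) :
    Set (Matrix X X ℝ) :=
  {Q | IsRateMatrix Q ∧ ∀ f : X → ℝ, ∀ x : X, Ql f x ≤ Q.mulVec f x}

/-- The set of rate matrices dominating a lower transition rate operator `Q̲` is closed,
convex, and has separately specified rows: any rate matrix whose rows are each picked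
from (rows of) elements of `𝒬_Q̲` again belongs to `𝒬_Q̲`. -/
theorem stmt12 {X : Type*} [Fintype X] [Nonempty X] [DecidableEq X]
    (Ql : (X → ℝ) → (X → ℝ)) (hQl : IsLowerTransitionRateOperator Ql) :
    IsClosed (dominatingSet Ql) ∧
    Convex ℝ (dominatingSet Ql) ∧
    (∀ Q : Matrix X X ℝ, IsRateMatrix Q →
      (∀ x : X, ∃ Q' ∈ dominatingSet Ql, Q x = Q' x) → Q ∈ dominatingSet Ql) := by
  refine ⟨?_, ?_, ?_⟩
  · have he : ∀ x y : X, Continuous fun Q : Matrix X X ℝ => Q x y := fun x y =>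
      (continuous_apply y).comp (continuous_apply x)
    have h1 : IsClosed {Q : Matrix X X ℝ | ∀ x y, x ≠ y → 0 ≤ Q x y} := by
      simp only [Set.setOf_forall]
      exact isClosed_iInter fun x => isClosed_iInter fun y => isClosed_iInter fun _ =>
        isClosed_le continuous_const (he x y)
    have h2 : IsClosed {Q : Matrix X X ℝ | ∀ x, ∑ y, Q x y = 0} := by
      simp only [Set.setOf_forall]
      exact isClosed_iInter fun x =>
        isClosed_eq (continuous_finsetSum _ fun y _ => he x y) continuous_const
    have h3 : IsClosed {Q : Matrix X X ℝ | ∀ f : X → ℝ, ∀ x : X, Ql f x ≤ Q.mulVec f x} := by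
      simp only [Set.setOf_forall]
      refine isClosed_iInter fun f => isClosed_iInter fun x =>
        isClosed_le continuous_const ?_
      simp only [Matrix.mulVec, dotProduct]
      exact continuous_finsetSum _ fun y _ => (he x y).mul continuous_const
    exact (h1.inter h2).inter h3
  · rintro P ⟨⟨hP1, hP2⟩, hP3⟩ Q ⟨⟨hQ1, hQ2⟩, hQ3⟩ a b ha hb hab
    refine ⟨⟨fun x y hxy => ?_, fun x => ?_⟩, fun f x => ?_⟩
    · exact add_nonneg (mul_nonneg ha (hP1 x y hxy)) (mul_nonneg hb (hQ1 x y hxy))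
    · simp [Finset.sum_add_distrib, ← Finset.mul_sum, hP2, hQ2]
    · rw [Matrix.add_mulVec, Matrix.smul_mulVec, Matrix.smul_mulVec]
      simp only [Pi.add_apply, Pi.smul_apply, smul_eq_mul]
      have e : Ql f x = a * Ql f x + b * Ql f x := by rw [← add_mul, hab, one_mul]
      rw [e]
      exact add_le_add (mul_le_mul_of_nonneg_left (hP3 f x) ha)
        (mul_le_mul_of_nonneg_left (hQ3 f x) hb)
  · intro Q hQ h
    refine ⟨hQ, fun f x => ?_⟩
    obtain ⟨Q', hQ', e⟩ := h x
    have := hQ'.2 f x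
    simp only [Matrix.mulVec] at this ⊢
    rw [e]
    exact this
end
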